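/- Let n ≥ 2, m ≥ 0 and c > 0, and let f ∈ C_c^∞(ℝ^{1+n}; S^m) be a smooth compactly supported symmetric m-tensor field. If the m-th momentum light ray transform of f vanishes identically, i.e. L^{m,m} f((t,x), ω) = 0 for all (t,x) ∈ ℝ^{1+n} and all ω ∈ ℝ^n \ {0}, then f = 0. -/

import Mathlib

open MeasureTheory Finset

noncomputable section

/-- The light direction `ω̃ = (c, ω) ∈ ℝ^{1+n}`. -/
def ld (n : ℕ) (c : ℝ) (ω : Fin n → ℝ) : Fin (n + 1) → ℝ := Fin.cons c ω

/-- The `k`-th momentum light ray transform of a rank-`m` symmetric tensor field,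
`L^{m,k} f((t,x), ω) = Σ ω̃_{i_1}⋯ω̃_{i_m} ∫ s^k f_{i_1…i_m}((t,x) + s ω̃) ds`. -/
def mlrt (n m : ℕ) (c : ℝ) (k : ℕ)
    (f : (Fin m → Fin (n + 1)) → (Fin (n + 1) → ℝ) → ℂ)
    (x : Fin (n + 1) → ℝ) (ω : Fin n → ℝ) : ℂ :=
  ∑ i : Fin m → Fin (n + 1),
    (∏ j, (ld n c ω (i j) : ℂ)) *
      ∫ s : ℝ, (s : ℂ) ^ k * f i (x + s • ld n c ω)

/-- A tensor field is symmetric: invariant under permutations of its indices. -/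
def IsSymmF (n m : ℕ) (f : (Fin m → Fin (n + 1)) → (Fin (n + 1) → ℝ) → ℂ) : Prop :=
  ∀ (σ : Equiv.Perm (Fin m)) (i : Fin m → Fin (n + 1)), f (i ∘ σ) = f i

/-- All components are smooth and compactly supported. -/
def IsCc (n m : ℕ) (f : (Fin m → Fin (n + 1)) → (Fin (n + 1) → ℝ) → ℂ) : Prop :=
  ∀ i, ContDiff ℝ (⊤ : ℕ∞) (f i) ∧ HasCompactSupport (f i)

/-- `ω ∈ S^{n-1}` (Euclidean unit sphere). -/
def onSphere (n : ℕ) (ω : Fin n → ℝ) : Prop := ∑ i, ω i ^ 2 = 1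

/-- `ω ∈ B_n(ω₀, δ)`: on the sphere and at Euclidean distance `< δ` from `ω₀`. -/
def inBall (n : ℕ) (ω₀ : Fin n → ℝ) (δ : ℝ) (ω : Fin n → ℝ) : Prop :=
  onSphere n ω ∧ ∑ i, (ω i - ω₀ i) ^ 2 < δ ^ 2


theorem aux_moments (m : ℕ) (g : ℝ → ℂ) (hg : Continuous g) (hs : HasCompactSupport g)
    (h : ∀ a : ℝ, ∫ s : ℝ, (s : ℂ) ^ m * g (a + s) = 0) :
    ∀ k ≤ m, ∫ s : ℝ, (s : ℂ) ^ k * g s = 0 := by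
  have hint : ∀ k : ℕ, Integrable (fun s : ℝ => (s : ℂ) ^ k * g s) := fun k =>
    Continuous.integrable_of_hasCompactSupport (by fun_prop) hs.mul_left
  let P : Polynomial ℂ := ∑ k ∈ range (m + 1),
    Polynomial.C ((∫ s : ℝ, (s : ℂ) ^ k * g s) * (m.choose k : ℂ)) * Polynomial.X ^ (m - k)
  have hP : ∀ a : ℝ, P.eval (a : ℂ) = 0 := by
    intro a
    have h1 := h (-a)
    have h2 : ∫ s : ℝ, (s : ℂ) ^ m * g (-a + s) = ∫ s : ℝ, ((s : ℂ) + a) ^ m * g s := by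
      rw [← integral_add_right_eq_self (fun s : ℝ => (s : ℂ) ^ m * g (-a + s)) a]
      congr 1; ext s; push_cast; congr 2; ring
    rw [h2] at h1
    rw [← h1, Polynomial.eval_finsetSum]
    simp only [add_pow, Finset.sum_mul]
    rw [integral_finsetSum]
    · apply Finset.sum_congr rfl
      intro k _
      simp only [Polynomial.eval_mul, Polynomial.eval_C, Polynomial.eval_pow, Polynomial.eval_X]
      rw [mul_assoc, ← integral_mul_const]
      congr 1; ext s; ring
    · intro k _
      refine ((hint k).mul_const ((m.choose k : ℂ) * (a:ℂ) ^ (m-k))).congr ?_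
      filter_upwards with s
      ring
  have hP0 : P = 0 := by
    apply Polynomial.eq_zero_of_infinite_isRoot
    refine Set.Infinite.mono (s := Set.range (fun a : ℝ => (a : ℂ))) ?_
      (Set.infinite_range_of_injective Complex.ofReal_injective)
    rintro _ ⟨a, rfl⟩
    exact hP a
  intro k hk
  have hc := congrArg (fun p => Polynomial.coeff p (m - k)) hP0
  simp only [P, Polynomial.finsetSum_coeff, Polynomial.coeff_C_mul, Polynomial.coeff_X_pow,
    Polynomial.coeff_zero] at hc
  rw [Finset.sum_eq_single k] at hc
  · have : (m.choose k : ℂ) ≠ 0 := by exact_mod_cast (Nat.choose_pos hk).ne'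
    simpa [this] using hc
  · intro b hb hbk
    have : b ≤ m := by simpa [Nat.lt_succ_iff] using hb
    rw [if_neg (by omega), mul_zero]
  · intro hh; exact absurd (Finset.mem_range.2 (by omega)) hh

theorem aux_poly (m : ℕ) (P : Polynomial ℂ) (hd : P.natDegree ≤ m) (r₀ : ℝ) (B : ℝ → ℝ)
    (hB : Continuous B)
    (h : ∀ᶠ r : ℝ in nhdsWithin r₀ {r₀}ᶜ, ‖P.eval (r : ℂ)‖ ≤ |r - r₀| ^ (m + 1) * B r) : P = 0 := by
  by_contra hP
  set k := P.rootMultiplicity (r₀ : ℂ) with hk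
  have hkm : k ≤ m := by
    refine le_trans ?_ ((P.card_roots').trans hd)
    rw [hk, ← Polynomial.count_roots]
    exact Multiset.count_le_card _ _
  obtain ⟨Q, hQ, hQ0⟩ := P.exists_eq_pow_rootMultiplicity_mul_and_not_dvd hP (r₀ : ℂ)
  rw [← hk] at hQ
  have hne : Q.eval (r₀ : ℂ) ≠ 0 := fun h0 => hQ0 (Polynomial.dvd_iff_isRoot.2 h0)
  have hle : ∀ᶠ r : ℝ in nhdsWithin r₀ {r₀}ᶜ, ‖Q.eval (r : ℂ)‖ ≤ |r - r₀| ^ (m + 1 - k) * B r := by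
    filter_upwards [h, self_mem_nhdsWithin] with r hr hne
    have hpos : 0 < |r - r₀| := abs_pos.2 (sub_ne_zero.2 hne)
    rw [hQ] at hr
    simp only [Polynomial.eval_mul, Polynomial.eval_pow, Polynomial.eval_sub, Polynomial.eval_X,
      Polynomial.eval_C, norm_mul, norm_pow] at hr
    rw [← Complex.ofReal_sub, Complex.norm_real, Real.norm_eq_abs] at hr
    rw [show m + 1 = k + (m + 1 - k) by omega, pow_add, mul_assoc] at hr
    exact le_of_mul_le_mul_left hr (by positivity)
  have hc1 : Filter.Tendsto (fun r : ℝ => ‖Q.eval (r : ℂ)‖) (nhdsWithin r₀ {r₀}ᶜ)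
      (nhds ‖Q.eval (r₀ : ℂ)‖) :=
    (Continuous.tendsto (by fun_prop) r₀).mono_left nhdsWithin_le_nhds
  have hc2 : Filter.Tendsto (fun r : ℝ => |r - r₀| ^ (m + 1 - k) * B r) (nhdsWithin r₀ {r₀}ᶜ)
      (nhds (|r₀ - r₀| ^ (m + 1 - k) * B r₀)) :=
    (Continuous.tendsto (f := fun r : ℝ => |r - r₀| ^ (m + 1 - k) * B r) (by fun_prop) r₀).mono_left
      nhdsWithin_le_nhds
  have := le_of_tendsto_of_tendsto hc1 hc2 hle
  rw [sub_self, abs_zero, zero_pow (by omega), zero_mul] at this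
  exact hne (norm_le_zero_iff.1 this)

theorem aux_sym (N m : ℕ) (c : ℝ) (hc : 0 < c) (a : (Fin m → Fin (N + 1)) → ℂ)
    (hs : ∀ (σ : Equiv.Perm (Fin m)) i, a (i ∘ σ) = a i)
    (h : ∀ v : Fin (N + 1) → ℝ, v 0 = c → ∑ i, (∏ j, (v (i j) : ℂ)) * a i = 0) : ∀ i, a i = 0 := by
  let P : MvPolynomial (Fin (N + 1)) ℂ := ∑ i : Fin m → Fin (N + 1),
    MvPolynomial.C (a i) * ∏ j, MvPolynomial.X (i j)
  have h1 : ∀ v : Fin (N + 1) → ℝ, v 0 ≠ 0 → ∑ i, (∏ j, (v (i j) : ℂ)) * a i = 0 := by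
    intro v hv
    have h2 := h (fun k => c / v 0 * v k) (by field_simp)
    simp only [Complex.ofReal_mul, Finset.prod_mul_distrib, Finset.prod_const, mul_assoc] at h2
    rw [← Finset.mul_sum] at h2
    refine (mul_eq_zero.1 h2).resolve_left (pow_ne_zero _ ?_)
    exact_mod_cast div_ne_zero hc.ne' hv
  have hP : MvPolynomial.X 0 * P = 0 := by
    apply MvPolynomial.funext_set (s := fun _ => Set.range (fun r : ℝ => (r : ℂ)))
      (fun _ => Set.infinite_range_of_injective Complex.ofReal_injective)
    intro x hx
    choose v hv using fun k => hx k (Set.mem_univ k)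
    obtain rfl : (fun k => (v k : ℂ)) = x := funext hv
    by_cases h0 : v 0 = 0
    · simp [h0]
    · have := h1 v h0
      simp only [P, map_mul, map_sum, map_prod, MvPolynomial.eval_X, MvPolynomial.eval_C, map_zero]
      rw [Finset.sum_congr rfl (fun i _ => mul_comm (a i) _), this, mul_zero]
  have hP0 : P = 0 := (mul_eq_zero.1 hP).resolve_left (MvPolynomial.X_ne_zero 0)
  intro i
  have hm : ∀ i : Fin m → Fin (N + 1), (∏ j, MvPolynomial.X (R := ℂ) (i j)) =
      MvPolynomial.monomial (∑ j, Finsupp.single (i j) 1) 1 := by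
    intro i
    rw [MvPolynomial.monomial_sum_one]; rfl
  have hco := congrArg (MvPolynomial.coeff (∑ j, Finsupp.single (i j) 1)) hP0
  simp only [P, hm, MvPolynomial.coeff_sum, MvPolynomial.coeff_C_mul, MvPolynomial.coeff_monomial,
    MvPolynomial.coeff_zero] at hco
  have key : ∀ i' : Fin m → Fin (N + 1), (∑ j, Finsupp.single (i' j) 1 : Fin (N+1) →₀ ℕ) =
      ∑ j, Finsupp.single (i j) 1 → a i' = a i := by
    intro i' he
    have hcard : ∀ k, Fintype.card {j // i' j = k} = Fintype.card {j // i j = k} := by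
      intro k
      have := DFunLike.congr_fun he k
      simp only [Finsupp.finsetSum_apply, Finsupp.single_apply] at this
      rw [Fintype.card_subtype, Fintype.card_subtype, Finset.card_filter, Finset.card_filter]
      exact this
    let σ : Equiv.Perm (Fin m) := Equiv.ofFiberEquiv (f := i') (g := i)
      (fun k => Fintype.equivOfCardEq (hcard k))
    rw [← hs σ i]
    congr 1
    ext1 j
    exact (Equiv.ofFiberEquiv_map _ j).symm
  have : ∑ i' : Fin m → Fin (N + 1), (if (∑ j, Finsupp.single (i' j) 1 : Fin (N+1) →₀ ℕ) =
      ∑ j, Finsupp.single (i j) 1 then a i else 0) = 0 := by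
    refine Eq.trans ?_ hco
    apply Finset.sum_congr rfl
    intro i' _
    split_ifs with hh
    · rw [key i' hh, mul_one]
    · simp
  rw [← Finset.sum_filter, Finset.sum_const, nsmul_eq_mul] at this
  refine (mul_eq_zero.1 this).resolve_left ?_
  have : 0 < (Finset.univ.filter (fun i' : Fin m → Fin (N + 1) =>
      (∑ j, Finsupp.single (i' j) 1 : Fin (N+1) →₀ ℕ) = ∑ j, Finsupp.single (i j) 1)).card :=
    Finset.card_pos.2 ⟨i, by simp⟩
  exact_mod_cast this.ne'

theorem aux_inj (N : ℕ) (g : (Fin (N + 1) → ℝ) → ℂ) (hg : Continuous g) (hs : HasCompactSupport g)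
    (k : Fin (N + 1))
    (h : ∀ ξ : Fin (N + 1) → ℝ, ξ k ≠ 0 →
      ∫ y, g y * Complex.exp (-Complex.I * ((∑ l, y l * ξ l : ℝ) : ℂ)) = 0) : ∀ y, g y = 0 := by
  let G : EuclideanSpace ℝ (Fin (N + 1)) → ℂ := fun y => g (WithLp.ofLp y)
  have hGc : Continuous G := hg.comp (PiLp.continuous_ofLp 2 _)
  have hgi : Integrable g := hg.integrable_of_hasCompactSupport hs
  have hmp := PiLp.volume_preserving_ofLp (Fin (N + 1))
  have hGi : Integrable G := hmp.integrable_comp_of_integrable hgi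
  have hF : ∀ w : EuclideanSpace ℝ (Fin (N + 1)), w k ≠ 0 → FourierTransform.fourier G w = 0 := by
    intro w hw
    rw [Real.fourier_eq']
    have h1 := h (fun l => 2 * Real.pi * w l) (by simp [hw, Real.pi_ne_zero])
    rw [← hmp.integral_comp (MeasurableEquiv.toLp 2 (Fin (N + 1) → ℝ)).symm.measurableEmbedding] at h1
    rw [← h1]
    congr 1; ext y
    rw [smul_eq_mul, mul_comm]
    congr 2
    simp only [PiLp.inner_apply, RCLike.inner_apply, conj_trivial]
    push_cast
    simp only [Finset.mul_sum, Finset.sum_mul]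
    apply Finset.sum_congr rfl
    intro l _
    ring
  have hFc : Continuous (FourierTransform.fourier G) :=
    VectorFourier.fourierIntegral_continuous Real.continuous_fourierChar
      (by exact continuous_inner) hGi
  have hF0 : FourierTransform.fourier G = 0 := by
    have hd : Dense {w : EuclideanSpace ℝ (Fin (N + 1)) | w k ≠ 0} := by
      intro w
      rw [mem_closure_iff_seq_limit]
      by_cases hw : w k = 0
      · refine ⟨fun j => w + (1 / ((j : ℝ) + 1)) • EuclideanSpace.single k (1 : ℝ), ?_, ?_⟩
        · intro j
          simp [hw]
          positivity
        · have := (tendsto_one_div_add_atTop_nhds_zero_nat (𝕜 := ℝ)).smul_const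
            (EuclideanSpace.single k (1 : ℝ))
          simpa using this.const_add w
      · exact ⟨fun _ => w, fun _ => hw, tendsto_const_nhds⟩
    exact hFc.ext_on hd continuous_zero (fun w hw => hF w hw)
  have hinv := hGc.fourierInv_fourier_eq hGi (by rw [hF0]; exact integrable_zero _ _ _)
  intro y
  have := congrFun hinv (WithLp.toLp 2 y)
  rw [hF0, Real.fourierInv_eq'] at this
  simpa [G] using this.symm

def auxHomeo (n : ℕ) (ω : Fin n → ℝ) : (ℝ × (Fin n → ℝ)) ≃ₜ (Fin (n + 1) → ℝ) where
  toFun p := Fin.cons p.1 (p.2 + p.1 • ω)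
  invFun y := (y 0, Fin.tail y - y 0 • ω)
  left_inv p := by simp
  right_inv y := by simp
  continuous_toFun := by
    refine continuous_pi fun i => ?_
    refine Fin.cases ?_ (fun j => ?_) i <;> simp <;> fun_prop
  continuous_invFun := by
    simp only [Fin.tail_def]
    fun_prop

theorem aux_fubini (n : ℕ) (c : ℝ) (hc : 0 < c) (ω : Fin n → ℝ) (g : (Fin (n + 1) → ℝ) → ℂ)
    (hg : Continuous g) (hs : HasCompactSupport g)
    (h : ∀ x : Fin n → ℝ, ∫ s : ℝ, g ((Fin.cons 0 x : Fin (n + 1) → ℝ) + s • ld n c ω) = 0) :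
    ∫ y, g y = 0 := by
  have hi : ∀ ω, Integrable (fun p : ℝ × (Fin n → ℝ) => g (Fin.cons p.1 (p.2 + p.1 • ω))) :=
    fun ω => Continuous.integrable_of_hasCompactSupport
      (hg.comp (auxHomeo n ω).continuous) (hs.comp_homeomorph (auxHomeo n ω))
  have hem := (volume_preserving_piFinSuccAbove (fun _ : Fin (n + 1) => ℝ) 0).symm
  rw [← hem.integral_comp' (g := g)]
  have e1 : ∀ p : ℝ × (Fin n → ℝ), (MeasurableEquiv.piFinSuccAbove (fun _ : Fin (n + 1) => ℝ) 0).symm p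
      = Fin.cons p.1 p.2 := by
    intro p
    simp [MeasurableEquiv.piFinSuccAbove_symm_apply, Fin.insertNthEquiv]
  simp only [e1]
  rw [Measure.volume_eq_prod, integral_prod _ (by
    have h0 := hi 0
    simp only [smul_zero, add_zero] at h0
    exact h0)]
  have e2 : ∀ t : ℝ, ∫ x : Fin n → ℝ, g (Fin.cons t x) =
      ∫ x : Fin n → ℝ, g (Fin.cons t (x + t • (c⁻¹ • ω))) := fun t =>
    (integral_add_right_eq_self (fun x : Fin n → ℝ => g (Fin.cons t x)) _).symm
  simp only [e2]
  rw [integral_integral_swap (hi (c⁻¹ • ω))]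
  have e3 : ∀ x : Fin n → ℝ, ∫ t : ℝ, g (Fin.cons t (x + t • (c⁻¹ • ω))) = 0 := by
    intro x
    have := Measure.integral_comp_div
      (fun s : ℝ => g ((Fin.cons 0 x : Fin (n + 1) → ℝ) + s • ld n c ω)) c
    rw [h x, smul_zero] at this
    rw [← this]
    congr 1; ext t; congr 1; ext i
    refine Fin.cases ?_ (fun j => ?_) i
    · simp [ld]; field_simp
    · simp [ld]; field_simp
  simp [e3]

/-- the contracted field -/
def Fv (n m : ℕ) (f : (Fin m → Fin (n + 1)) → (Fin (n + 1) → ℝ) → ℂ) (v y : Fin (n + 1) → ℝ) : ℂ :=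
  ∑ i : Fin m → Fin (n + 1), (∏ j, (v (i j) : ℂ)) * f i y

theorem Fv_cont {n m : ℕ} {f : (Fin m → Fin (n + 1)) → (Fin (n + 1) → ℝ) → ℂ} (hreg : IsCc n m f)
    (v : Fin (n + 1) → ℝ) : Continuous (Fv n m f v) :=
  continuous_finsetSum _ fun i _ => continuous_const.mul (hreg i).1.continuous

theorem aux_cs_sum {ι X : Type*} [TopologicalSpace X] (s : Finset ι) (f : ι → X → ℂ)
    (h : ∀ i ∈ s, HasCompactSupport (f i)) : HasCompactSupport (fun x => ∑ i ∈ s, f i x) := by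
  classical
  induction s using Finset.induction_on with
  | empty => exact (HasCompactSupport.zero : HasCompactSupport (0 : X → ℂ))
  | insert a s ha ih =>
    simp only [Finset.sum_insert ha]
    exact (h a (by simp)).add (ih fun i hi => h i (by simp [hi]))

theorem Fv_cs {n m : ℕ} {f : (Fin m → Fin (n + 1)) → (Fin (n + 1) → ℝ) → ℂ} (hreg : IsCc n m f)
    (v : Fin (n + 1) → ℝ) : HasCompactSupport (Fv n m f v) :=
  aux_cs_sum _ _ fun i _ => (hreg i).2.mul_left

theorem aux_line_cs {N : ℕ} {g : (Fin (N + 1) → ℝ) → ℂ} (hs : HasCompactSupport g)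
    (x v : Fin (N + 1) → ℝ) (hv : v ≠ 0) : HasCompactSupport (fun s : ℝ => g (x + s • v)) := by
  have h1 : Topology.IsClosedEmbedding (fun s : ℝ => x + s • v) :=
    (Homeomorph.addLeft x).isClosedEmbedding.comp (isClosedEmbedding_smul_left hv)
  exact hs.comp_isClosedEmbedding h1

theorem aux_line_moments {n m : ℕ} {c : ℝ} (hc : 0 < c)
    {f : (Fin m → Fin (n + 1)) → (Fin (n + 1) → ℝ) → ℂ} (hreg : IsCc n m f)
    (h : ∀ (x : Fin (n + 1) → ℝ) (ω : Fin n → ℝ), ω ≠ 0 → mlrt n m c m f x ω = 0)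
    (x : Fin (n + 1) → ℝ) (ω : Fin n → ℝ) (hω : ω ≠ 0) (k : ℕ) (hk : k ≤ m) :
    ∫ s : ℝ, (s : ℂ) ^ k * Fv n m f (ld n c ω) (x + s • ld n c ω) = 0 := by
  have hv : ld n c ω ≠ 0 := fun h0 => hc.ne' (by simpa [ld] using congrFun h0 0)
  refine aux_moments m (fun s : ℝ => Fv n m f (ld n c ω) (x + s • ld n c ω))
    ((Fv_cont hreg _).comp (by fun_prop)) (aux_line_cs (Fv_cs hreg _) x _ hv) ?_ k hk
  intro a
  rw [← h (x + a • ld n c ω) ω hω, mlrt]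
  simp only [Fv, Finset.mul_sum]
  rw [integral_finsetSum]
  · apply Finset.sum_congr rfl
    intro i _
    rw [← integral_const_mul]
    congr 1; ext s
    rw [add_smul, ← add_assoc]
    ring
  · intro i _
    apply Continuous.integrable_of_hasCompactSupport
    · have := (hreg i).1.continuous
      fun_prop
    · refine HasCompactSupport.mul_left (HasCompactSupport.mul_left ?_)
      have := aux_line_cs (hreg i).2 (x + a • ld n c ω) _ hv
      simpa only [add_smul, add_assoc] using this

theorem aux_moment_fourier {n m : ℕ} {c : ℝ} (hc : 0 < c)
    {f : (Fin m → Fin (n + 1)) → (Fin (n + 1) → ℝ) → ℂ} (hreg : IsCc n m f)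
    (h : ∀ (x : Fin (n + 1) → ℝ) (ω : Fin n → ℝ), ω ≠ 0 → mlrt n m c m f x ω = 0)
    (ω : Fin n → ℝ) (hω : ω ≠ 0) (ξ : Fin (n + 1) → ℝ) (hξ : ∑ l, ld n c ω l * ξ l = 0)
    (k : ℕ) (hk : k ≤ m) :
    ∫ y : Fin (n + 1) → ℝ, Fv n m f (ld n c ω) y *
      Complex.exp (-Complex.I * ((∑ l, y l * ξ l : ℝ) : ℂ)) * (y 0 : ℂ) ^ k = 0 := by
  apply aux_fubini n c hc ω
  · have := Fv_cont hreg (ld n c ω)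
    fun_prop
  · exact (Fv_cs hreg _).mul_right.mul_right
  · intro x
    have h1 := aux_line_moments hc hreg h (Fin.cons 0 x) ω hω k hk
    have h2 : ∀ s : ℝ, ∑ l, ((Fin.cons 0 x : Fin (n + 1) → ℝ) + s • ld n c ω) l * ξ l =
        ∑ l, (Fin.cons 0 x : Fin (n + 1) → ℝ) l * ξ l := by
      intro s
      simp only [Pi.add_apply, Pi.smul_apply, smul_eq_mul, add_mul, Finset.sum_add_distrib, mul_assoc]
      rw [← Finset.mul_sum, hξ, mul_zero, add_zero]
    simp only [h2]
    have h3 := congrArg (fun z => z * (Complex.exp (-Complex.I *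
      ((∑ l, (Fin.cons 0 x : Fin (n + 1) → ℝ) l * ξ l : ℝ) : ℂ)) * (c : ℂ) ^ k)) h1
    simp only [zero_mul] at h3
    rw [← integral_mul_const] at h3
    rw [← h3]
    congr 1; ext s
    have h4 : ((Fin.cons 0 x : Fin (n + 1) → ℝ) + s • ld n c ω) 0 = s * c := by simp [ld]
    rw [h4]
    push_cast
    ring

theorem aux_bound {n m : ℕ} {c : ℝ} (hc : 0 < c)
    {f : (Fin m → Fin (n + 1)) → (Fin (n + 1) → ℝ) → ℂ} (hreg : IsCc n m f)
    (h : ∀ (x : Fin (n + 1) → ℝ) (ω : Fin n → ℝ), ω ≠ 0 → mlrt n m c m f x ω = 0)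
    (ω : Fin n → ℝ) (hω : ω ≠ 0) (ξ : Fin (n + 1) → ℝ)
    (σ : ℝ) (hσ : ∑ l, ld n c ω l * ξ l = σ * c) (hσ1 : |σ| ≤ 1) :
    ‖∫ y : Fin (n + 1) → ℝ, Fv n m f (ld n c ω) y *
      Complex.exp (-Complex.I * ((∑ l, y l * ξ l : ℝ) : ℂ))‖ ≤
    |σ| ^ (m + 1) * ∑ i : Fin m → Fin (n + 1), (∏ j, |ld n c ω (i j)|) *
      ∫ y : Fin (n + 1) → ℝ, ‖f i y‖ * (|y 0| ^ (m + 1) * Real.exp |y 0|) := by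
  set v := ld n c ω with hv
  let ξ' : Fin (n + 1) → ℝ := ξ - Pi.single 0 σ
  have hy : ∀ y : Fin (n + 1) → ℝ, ∑ l, y l * ξ l = ∑ l, y l * ξ' l + y 0 * σ := by
    intro y
    simp [ξ', mul_sub, Finset.sum_sub_distrib, Pi.single_apply]
  have hξ' : ∑ l, v l * ξ' l = 0 := by
    have := hy v
    have h0 : v 0 = c := by simp [hv, ld]
    rw [hσ, h0] at this
    linarith
  have hFc := Fv_cont hreg v
  have hFs := Fv_cs hreg v
  have hT : ∫ y : Fin (n + 1) → ℝ, Fv n m f v y *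
      Complex.exp (-Complex.I * ((∑ l, y l * ξ' l : ℝ) : ℂ)) *
      ∑ k ∈ range (m + 1), (-Complex.I * ((y 0 * σ : ℝ) : ℂ)) ^ k / (k.factorial : ℂ) = 0 := by
    simp only [Finset.mul_sum]
    rw [integral_finsetSum]
    · apply Finset.sum_eq_zero
      intro k hk
      have h1 := aux_moment_fourier hc hreg h ω hω ξ' hξ' k (by simpa [Nat.lt_succ_iff] using hk)
      have h3 := congrArg (fun z => z * ((-Complex.I * σ) ^ k / (k.factorial : ℂ))) h1
      simp only [zero_mul] at h3
      rw [← integral_mul_const] at h3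
      rw [← h3]
      congr 1; ext y
      push_cast
      ring
    · intro k _
      exact Continuous.integrable_of_hasCompactSupport (by fun_prop) hFs.mul_right.mul_right
  have hK : ∀ i, Integrable (fun y : Fin (n + 1) → ℝ =>
      ‖f i y‖ * (|y 0| ^ (m + 1) * Real.exp |y 0|)) := fun i =>
    Continuous.integrable_of_hasCompactSupport
      (by have := (hreg i).1.continuous; fun_prop) (hreg i).2.norm.mul_right
  rw [← sub_zero (∫ y : Fin (n + 1) → ℝ, _), ← hT, ← integral_sub]
  rotate_left
  · exact Continuous.integrable_of_hasCompactSupport (by fun_prop) hFs.mul_right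
  · exact Continuous.integrable_of_hasCompactSupport (by fun_prop) hFs.mul_right.mul_right
  simp only [← integral_const_mul]
  rw [← integral_finsetSum _ (fun i _ => (hK i).const_mul _), ← integral_const_mul]
  apply norm_integral_le_of_norm_le
  · exact (integrable_finsetSum _ (fun i _ => (hK i).const_mul _)).const_mul _
  filter_upwards with y
  have e1 : Complex.exp (-Complex.I * ((∑ l, y l * ξ l : ℝ) : ℂ)) =
      Complex.exp (-Complex.I * ((∑ l, y l * ξ' l : ℝ) : ℂ)) *
      Complex.exp (-Complex.I * ((y 0 * σ : ℝ) : ℂ)) := by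
    rw [hy y, ← Complex.exp_add]
    congr 1
    push_cast
    ring
  rw [e1, ← mul_assoc, ← mul_sub, norm_mul, norm_mul]
  have e2 : ‖Complex.exp (-Complex.I * ((∑ l, y l * ξ' l : ℝ) : ℂ))‖ = 1 := by
    rw [Complex.norm_exp]; simp
  have e3 := Complex.norm_exp_sub_sum_le_norm_mul_exp (-Complex.I * ((y 0 * σ : ℝ) : ℂ)) (m + 1)
  have e4 : ‖-Complex.I * ((y 0 * σ : ℝ) : ℂ)‖ = |y 0| * |σ| := by
    rw [norm_mul, norm_neg, Complex.norm_I, one_mul, Complex.norm_real, Real.norm_eq_abs, abs_mul]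
  rw [e4] at e3
  have e5 : ‖Fv n m f v y‖ ≤ ∑ i : Fin m → Fin (n + 1), (∏ j, |v (i j)|) * ‖f i y‖ := by
    refine (norm_sum_le _ _).trans (le_of_eq ?_)
    apply Finset.sum_congr rfl
    intro i _
    rw [norm_mul, norm_prod]
    simp [Complex.norm_real]
  have e6 : Real.exp (|y 0| * |σ|) ≤ Real.exp |y 0| :=
    Real.exp_le_exp.2 (mul_le_of_le_one_right (abs_nonneg _) hσ1)
  rw [e2, mul_one]
  calc _ ≤ (∑ i : Fin m → Fin (n + 1), (∏ j, |v (i j)|) * ‖f i y‖) *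
        ((|y 0| * |σ|) ^ (m + 1) * Real.exp |y 0|) := by
        refine mul_le_mul e5 (e3.trans ?_) (norm_nonneg _) ((norm_nonneg _).trans e5)
        gcongr
    _ = _ := by
        rw [Finset.sum_mul, Finset.mul_sum]
        apply Finset.sum_congr rfl
        intro i _
        rw [mul_pow]
        ring

theorem aux_G_zero {n m : ℕ} {c : ℝ} (hc : 0 < c)
    {f : (Fin m → Fin (n + 1)) → (Fin (n + 1) → ℝ) → ℂ} (hreg : IsCc n m f)
    (h : ∀ (x : Fin (n + 1) → ℝ) (ω : Fin n → ℝ), ω ≠ 0 → mlrt n m c m f x ω = 0)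
    (ω : Fin n → ℝ) (ξ : Fin (n + 1) → ℝ) (hξ : Fin.tail ξ ≠ 0) :
    ∑ i : Fin m → Fin (n + 1), (∏ j, (ld n c ω (i j) : ℂ)) *
      ∫ y : Fin (n + 1) → ℝ, f i y * Complex.exp (-Complex.I * ((∑ l, y l * ξ l : ℝ) : ℂ)) = 0 := by
  set A : (Fin m → Fin (n + 1)) → ℂ := fun i =>
    ∫ y : Fin (n + 1) → ℝ, f i y * Complex.exp (-Complex.I * ((∑ l, y l * ξ l : ℝ) : ℂ)) with hA
  have hGA : ∀ v : Fin (n + 1) → ℝ, ∫ y : Fin (n + 1) → ℝ, Fv n m f v y *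
      Complex.exp (-Complex.I * ((∑ l, y l * ξ l : ℝ) : ℂ)) =
      ∑ i : Fin m → Fin (n + 1), (∏ j, (v (i j) : ℂ)) * A i := by
    intro v
    simp only [Fv, Finset.sum_mul, hA]
    rw [integral_finsetSum]
    · apply Finset.sum_congr rfl
      intro i _
      rw [← integral_const_mul]
      congr 1; ext y; ring
    · intro i _
      apply Continuous.integrable_of_hasCompactSupport
      · have := (hreg i).1.continuous
        fun_prop
      · exact (hreg i).2.mul_left.mul_right
  set η := Fin.tail ξ with hη
  let w : Fin (n + 1) → ℝ := Fin.cons 0 η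
  let P : Polynomial ℂ := ∑ i : Fin m → Fin (n + 1),
    (∏ j, (Polynomial.C (w (i j) : ℂ) * Polynomial.X + Polynomial.C (ld n c ω (i j) : ℂ))) *
      Polynomial.C (A i)
  have hline : ∀ r : ℝ, ld n c (ω + r • η) = fun l => w l * r + ld n c ω l := by
    intro r
    ext l
    refine Fin.cases ?_ (fun j => ?_) l
    · simp [ld, w]
    · simp [ld, w]; ring
  have hPe : ∀ r : ℝ, P.eval (r : ℂ) =
      ∑ i : Fin m → Fin (n + 1), (∏ j, (ld n c (ω + r • η) (i j) : ℂ)) * A i := by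
    intro r
    simp [P, Polynomial.eval_finsetSum, Polynomial.eval_prod, hline]
  have hdeg : P.natDegree ≤ m := by
    apply Polynomial.natDegree_sum_le_of_forall_le
    intro i _
    refine (Polynomial.natDegree_mul_C_le _ _).trans ((Polynomial.natDegree_prod_le _ _).trans ?_)
    refine (Finset.sum_le_card_nsmul _ _ 1 fun j _ => Polynomial.natDegree_linear_le).trans ?_
    simp
  have hq : 0 < ∑ l, η l * η l := by
    obtain ⟨l, hl⟩ := Function.ne_iff.1 hξ
    exact Finset.sum_pos' (fun l _ => mul_self_nonneg _) ⟨l, Finset.mem_univ _, mul_self_pos.2 hl⟩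
  set q := ∑ l, η l * η l with hqdef
  set p := ∑ l, ld n c ω l * ξ l with hp
  let r₀ : ℝ := - p / q
  have hσ : ∀ r : ℝ, ∑ l, ld n c (ω + r • η) l * ξ l = (q / c * (r - r₀)) * c := by
    intro r
    have h1 : ∑ l, ld n c (ω + r • η) l * ξ l = r * q + p := by
      simp only [hline, add_mul, Finset.sum_add_distrib]
      rw [← hp, hqdef, Finset.mul_sum, Fin.sum_univ_succ]
      simp only [w, Fin.cons_zero, Fin.cons_succ, zero_mul, zero_add]
      congr 1
      apply Finset.sum_congr rfl
      intro l _
      simp only [hη, Fin.tail]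
      ring
    rw [h1]
    simp only [r₀]
    field_simp
    ring
  have hP : P = 0 := by
    apply aux_poly m P hdeg r₀ (fun r => (q / c) ^ (m + 1) *
      ∑ i : Fin m → Fin (n + 1), (∏ j, |w (i j) * r + ld n c ω (i j)|) *
      ∫ y : Fin (n + 1) → ℝ, ‖f i y‖ * (|y 0| ^ (m + 1) * Real.exp |y 0|)) (by fun_prop)
    have hev1 : ∀ᶠ r : ℝ in nhdsWithin r₀ {r₀}ᶜ, |q / c * (r - r₀)| ≤ 1 := by
      apply Filter.Eventually.filter_mono nhdsWithin_le_nhds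
      have : Filter.Tendsto (fun r : ℝ => |q / c * (r - r₀)|) (nhds r₀)
          (nhds |q / c * (r₀ - r₀)|) :=
        Continuous.tendsto (f := fun r : ℝ => |q / c * (r - r₀)|) (by fun_prop) r₀
      refine (this.eventually_lt_const (u := 1) (by simp)).mono fun r hr => hr.le
    have hev2 : ∀ᶠ r : ℝ in nhdsWithin r₀ {r₀}ᶜ, ω + r • η ≠ 0 := by
      have hfin : {r : ℝ | ω + r • η = 0}.Subsingleton := by
        intro a ha b hb
        have : a • η = b • η := by
          have ha' : ω + a • η = 0 := ha
          have hb' : ω + b • η = 0 := hb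
          exact add_left_cancel (ha'.trans hb'.symm)
        exact smul_left_injective ℝ hξ this
      by_cases h0 : ω + r₀ • η = 0
      · filter_upwards [self_mem_nhdsWithin] with r hr hr0
        exact hr (hfin hr0 h0)
      · apply Filter.Eventually.filter_mono nhdsWithin_le_nhds
        have : Continuous (fun r : ℝ => ω + r • η) := by fun_prop
        exact this.continuousAt.eventually_ne h0
    filter_upwards [hev1, hev2] with r hr1 hr2
    have hb := aux_bound hc hreg h (ω + r • η) hr2 ξ _ (hσ r) hr1
    rw [hGA, ← hPe, abs_mul, mul_pow, abs_of_pos (div_pos hq hc), hline] at hb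
    refine hb.trans (le_of_eq ?_)
    ring
  have := hPe 0
  rw [hP, Polynomial.eval_zero, zero_smul, add_zero] at this
  exact this.symm

/-- If the `m`-th momentum light ray transform of a smooth compactly
supported symmetric `m`-tensor field vanishes for all base points and all directions
`ω ∈ ℝ^n \ {0}`, then the field vanishes. -/
theorem mlrt_full_data_injectivity
    (n m : ℕ) (hn : 2 ≤ n) (c : ℝ) (hc : 0 < c)
    (f : (Fin m → Fin (n + 1)) → (Fin (n + 1) → ℝ) → ℂ)
    (hsym : IsSymmF n m f) (hreg : IsCc n m f)
    (h : ∀ (x : Fin (n + 1) → ℝ) (ω : Fin n → ℝ), ω ≠ 0 →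
      mlrt n m c m f x ω = 0) :
    ∀ i x, f i x = 0 := by
  intro i
  let k : Fin n := ⟨0, by omega⟩
  apply aux_inj n (f i) (hreg i).1.continuous (hreg i).2 k.succ
  intro ξ hξ
  refine aux_sym n m c hc (fun i => ∫ y : Fin (n + 1) → ℝ, f i y *
    Complex.exp (-Complex.I * ((∑ l, y l * ξ l : ℝ) : ℂ))) ?_ ?_ i
  · intro σ i
    simp only [hsym σ i]
  · intro v hv
    have hvl : v = ld n c (Fin.tail v) := by
      rw [ld, ← hv, Fin.cons_self_tail]
    rw [hvl]
    exact aux_G_zero hc hreg h (Fin.tail v) ξ fun h0 => hξ (congrFun h0 k)
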